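/- arXiv:2201.04446 — 4 statements merged into one kernel-verified Lean document; each statement's English description precedes it below -/
import Mathlib

section
/- Let P be a finite poset and let L be the set of all lower sets (order ideals) of P, partially ordered by inclusion. Let Z be the square matrix over ℚ with rows and columns indexed by L defined by Z_{I,J} = 1 if I ⊆ J and Z_{I,J} = 0 otherwise, and let C := -Z⁻¹ · Zᵀ (the Coxeter matrix of the incidence algebra of L). Let ρ : L → L be the rowmotion bijection, which sends a lower set I to the complement of the upper closure of the set of maximal elements of I, and let (abusing notation) ρ also denote its permutation matrix, with ρ_{J,I} = 1 if J = ρ(I) and ρ_{J,I} = 0 otherwise. Then (ρᵀ · C)² is the identity matrix. -/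
attribute [local instance] Classical.propDecidable

open Matrix

variable {P : Type*}

/-- The upper closure of a subset `S` of a poset: all elements above some element of `S`. -/
def upClosure [PartialOrder P] (S : Set P) : Set P := {x | ∃ s ∈ S, s ≤ x}

/-- The set of maximal elements of a subset `I` of a poset. -/
def maxElts [PartialOrder P] (I : Set P) : Set P := {a ∈ I | ∀ b ∈ I, ¬ a < b}

/-- Rowmotion of a set: the complement of the upper closure of its set of maximal elements. -/
def rowmo [PartialOrder P] (I : Set P) : Set P := (upClosure (maxElts I))ᶜ

lemma isLowerSet_upClosure_compl [PartialOrder P] (S : Set P) :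
    IsLowerSet (upClosure S)ᶜ := by
  intro a b hba ha hb
  obtain ⟨s, hs, hle⟩ := hb
  exact ha ⟨s, hs, hle.trans hba⟩

/-- The distributive lattice of lower sets (order ideals) of `P`, ordered by inclusion. -/
abbrev LSet (P : Type*) [PartialOrder P] := {I : Set P // IsLowerSet I}

/-- The rowmotion bijection on the lattice of lower sets. -/
def rowmoL [PartialOrder P] (I : LSet P) : LSet P :=
  ⟨rowmo I.1, isLowerSet_upClosure_compl _⟩

/-- The maximal elements of a lower set, as a finset. -/
noncomputable def mxF [PartialOrder P] [Fintype P] (K : LSet P) : Finset P :=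
  Finset.univ.filter (fun x => x ∈ maxElts K.1)

lemma mem_mxF [PartialOrder P] [Fintype P] (K : LSet P) (x : P) :
    x ∈ mxF K ↔ x ∈ K.1 ∧ ∀ b ∈ K.1, ¬ x < b := by
  have h : x ∈ mxF K ↔ x ∈ maxElts K.1 := by simp [mxF]
  exact h

lemma exists_mxF_ge [PartialOrder P] [Fintype P] (K : LSet P) {x : P} (hx : x ∈ K.1) :
    ∃ y ∈ mxF K, x ≤ y := by
  obtain ⟨y, hxy, hy⟩ := (Set.toFinite K.1).exists_le_maximal hx
  exact ⟨y, (mem_mxF K y).2 ⟨hy.1, fun b hb hlt => hlt.not_ge (hy.2 hb hlt.le)⟩, hxy⟩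

lemma mxF_subset_iff [PartialOrder P] [Fintype P] (J I : LSet P) :
    J.1 ⊆ I.1 ↔ ∀ s ∈ mxF J, s ∈ I.1 := by
  constructor
  · intro h s hs
    exact h ((mem_mxF J s).1 hs).1
  · intro h x hx
    obtain ⟨y, hy, hxy⟩ := exists_mxF_ge J hx
    exact I.2 hxy (h y hy)

lemma mxF_injective [PartialOrder P] [Fintype P] :
    Function.Injective (mxF : LSet P → Finset P) := by
  intro I J h
  apply Subtype.ext
  apply Set.Subset.antisymm
  · rw [mxF_subset_iff, h]
    exact fun s hs => ((mem_mxF J s).1 hs).1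
  · rw [mxF_subset_iff, ← h]
    exact fun s hs => ((mem_mxF I s).1 hs).1

lemma exists_mxF_eq [PartialOrder P] [Fintype P] (J : LSet P) (T : Finset P)
    (hT : T ⊆ mxF J) : ∃ K : LSet P, mxF K = T := by
  have anti : ∀ a ∈ T, ∀ b ∈ T, ¬ a < b := fun a ha b hb =>
    ((mem_mxF J a).1 (hT ha)).2 b ((mem_mxF J b).1 (hT hb)).1
  refine ⟨⟨{x | ∃ t ∈ T, x ≤ t}, ?_⟩, ?_⟩
  · rintro a b hba ⟨t, ht, hat⟩
    exact ⟨t, ht, hba.trans hat⟩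
  · ext x
    rw [mem_mxF]
    constructor
    · rintro ⟨⟨t, ht, hxt⟩, h⟩
      rcases hxt.eq_or_lt with rfl | hlt
      · exact ht
      · exact absurd hlt (h t ⟨t, ht, le_rfl⟩)
    · intro hx
      refine ⟨⟨x, hx, le_rfl⟩, ?_⟩
      rintro b ⟨t, ht, hbt⟩ hxb
      exact anti x hx t ht (hxb.trans_le hbt)

lemma subset_rowmo_iff [PartialOrder P] [Fintype P] (I J : LSet P) :
    I.1 ⊆ (rowmoL J).1 ↔ ∀ s ∈ mxF J, s ∉ I.1 := by
  constructor
  · intro h s hs hsI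
    exact h hsI ⟨s, by simpa [mxF] using hs, le_rfl⟩
  · rintro h x hx ⟨s, hs, hsx⟩
    exact h s (by simpa [mxF] using hs) (I.2 hsx hx)

/-- The signed inclusion matrix of the sets of maximal elements. -/
noncomputable def Bmat (P : Type*) [PartialOrder P] [Fintype P] :
    Matrix (LSet P) (LSet P) ℚ :=
  fun K J => if mxF K ⊆ mxF J then ∏ _s ∈ mxF K, (-1 : ℚ) else 0

lemma sum_Bmat [PartialOrder P] [Fintype P] (f : P → ℚ) (J : LSet P) :
    ∑ K : LSet P, (∏ s ∈ mxF K, f s) * Bmat P K J = ∏ s ∈ mxF J, (1 - f s) := by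
  have h1 : ∏ s ∈ mxF J, (1 - f s) = ∏ s ∈ mxF J, (1 + -f s) := by
    simp only [sub_eq_add_neg]
  rw [h1, Finset.prod_one_add]
  simp only [Bmat, mul_ite, mul_zero, ← Finset.prod_mul_distrib, mul_neg, mul_one]
  rw [← Finset.sum_filter]
  refine Finset.sum_bij (fun K _ => mxF K) ?_ ?_ ?_ ?_
  · intro K hK
    simpa using hK
  · intro K _ K' _ h
    exact mxF_injective h
  · intro T hT
    obtain ⟨K, hK⟩ := exists_mxF_eq J T (by simpa using hT)
    refine ⟨K, ?_, hK⟩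
    simpa [hK] using hT
  · intro K _
    rfl

lemma prod_ind (S : Finset P) (p : P → Prop) [DecidablePred p] [Decidable (∀ s ∈ S, p s)] :
    ∏ s ∈ S, (if p s then (1 : ℚ) else 0) = if ∀ s ∈ S, p s then 1 else 0 := by
  rw [Finset.prod_ite_zero]
  by_cases h : ∀ s ∈ S, p s
  · rw [if_pos h, if_pos h]; simp
  · rw [if_neg h, if_neg h]

lemma Z_isUnit [PartialOrder P] [Fintype P] (Z : Matrix (LSet P) (LSet P) ℚ)
    (hZ : ∀ I J : LSet P, Z I J = if I.1 ⊆ J.1 then 1 else 0) : IsUnit Zᵀ := by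
  rw [← Matrix.mulVec_injective_iff_isUnit]
  have key : ∀ v : LSet P → ℚ, Zᵀ *ᵥ v = 0 → v = 0 := by
    intro v hv
    funext I
    induction I using WellFoundedLT.induction with
    | ind I ih =>
      have h := congrFun hv I
      simp only [Matrix.mulVec, dotProduct, Matrix.transpose_apply, hZ, Pi.zero_apply] at h
      rw [Finset.sum_eq_single I] at h
      · simpa using h
      · intro J _ hJ
        by_cases hs : J.1 ⊆ I.1
        · rw [ih J (lt_of_le_of_ne hs hJ)]
          simp
        · simp [hs]
      · simp
  intro v w hvw
  have := key (v - w) (by rw [Matrix.mulVec_sub]; exact sub_eq_zero.2 hvw)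
  exact sub_eq_zero.1 this

theorem rowmotion_coxeter_order_two [PartialOrder P] [Fintype P]
    (Z C ρ : Matrix (LSet P) (LSet P) ℚ)
    (hZ : ∀ I J : LSet P, Z I J = if I.1 ⊆ J.1 then 1 else 0)
    (hC : C = -(Z⁻¹ * Zᵀ))
    (hρ : ∀ J I : LSet P, ρ J I = if J = rowmoL I then 1 else 0) :
    (ρᵀ * C) ^ 2 = 1 := by
  have hZtU := Z_isUnit Z hZ
  have hZU : IsUnit Z := (Matrix.isUnit_transpose Z).1 hZtU
  have hZt : ∀ I J, Zᵀ I J = ∏ s ∈ mxF J, (if s ∈ I.1 then (1 : ℚ) else 0) := by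
    intro I J
    rw [prod_ind, Matrix.transpose_apply, hZ]
    by_cases h : ∀ s ∈ mxF J, s ∈ I.1
    · rw [if_pos h, if_pos ((mxF_subset_iff J I).2 h)]
    · rw [if_neg h, if_neg (fun h' => h ((mxF_subset_iff J I).1 h'))]
  have hM : ∀ I J, (Z * ρ) I J = ∏ s ∈ mxF J, (if s ∉ I.1 then (1 : ℚ) else 0) := by
    intro I J
    have h0 : (Z * ρ) I J = Z I (rowmoL J) := by
      rw [Matrix.mul_apply]
      simp [hρ]
    have h1 := prod_ind (mxF J) (fun s => s ∉ I.1)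
    refine h0.trans (Eq.trans ?_ h1.symm)
    rw [hZ]
    by_cases h : ∀ s ∈ mxF J, s ∉ I.1
    · rw [if_pos h, if_pos ((subset_rowmo_iff I J).2 h)]
    · rw [if_neg h, if_neg (fun h' => h ((subset_rowmo_iff I J).1 h'))]
  have e1 : Z * ρ = Zᵀ * Bmat P := by
    ext I J
    rw [hM, Matrix.mul_apply]
    simp only [hZt]
    rw [sum_Bmat]
    refine Finset.prod_congr rfl fun s _ => ?_
    by_cases h : s ∈ I.1 <;> simp [h]
  have e2 : Zᵀ = Z * ρ * Bmat P := by
    ext I J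
    rw [hZt, Matrix.mul_apply]
    simp only [hM]
    rw [sum_Bmat]
    refine Finset.prod_congr rfl fun s _ => ?_
    by_cases h : s ∈ I.1 <;> simp [h]
  have hB : Bmat P * Bmat P = 1 := by
    apply hZtU.mul_left_cancel
    rw [← mul_assoc, ← e1, ← e2, mul_one]
  have hinj : Function.Injective (rowmoL : LSet P → LSet P) := by
    have hρB : IsUnit ρ := by
      have hBU : IsUnit (Bmat P) := IsUnit.of_mul_eq_one _ hB
      have : IsUnit (Z * ρ) := by rw [e1]; exact hZtU.mul hBU
      have h2 : ρ = Z⁻¹ * (Z * ρ) := by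
        rw [Matrix.nonsing_inv_mul_cancel_left _ _ ((Matrix.isUnit_iff_isUnit_det Z).1 hZU)]
      rw [h2]
      exact (Matrix.isUnit_nonsing_inv_iff.2 hZU).mul this
    intro I J h
    have hi := Matrix.mulVec_injective_iff_isUnit.2 hρB
    have : (Pi.single I 1 : LSet P → ℚ) = Pi.single J 1 := by
      apply hi
      funext K
      simp [hρ, h]
    by_contra hne
    have := congrFun this I
    simp [hne] at this
  have hρρ : ρᵀ * ρ = 1 := by
    ext I J
    rw [Matrix.mul_apply, Matrix.one_apply]
    simp [hρ, hinj.eq_iff, eq_comm]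
  have hCB : ρᵀ * C = -Bmat P := by
    rw [hC]
    conv_lhs => rw [e2]
    rw [mul_assoc Z,
      Matrix.nonsing_inv_mul_cancel_left _ _ ((Matrix.isUnit_iff_isUnit_det Z).1 hZU),
      mul_neg, ← mul_assoc, hρρ, one_mul]
  rw [hCB, neg_sq, sq, hB]
end

section
/- Let P be a finite poset and let L be the set of all lower sets (order ideals) of P, partially ordered by inclusion. Let Z be the square matrix over ℚ with rows and columns indexed by L defined by Z_{I,J} = 1 if I ⊆ J and Z_{I,J} = 0 otherwise, and let C := -Z⁻¹ · Zᵀ. Then for every antichain S of P, the column of C indexed by I(S) equals -∑_{T ⊆ S} (-1)^{|T|} e_{M(T)}, where e_J denotes the standard basis column vector indexed by the lower set J. That is, for all lower sets J of P: C_{J, I(S)} = -(-1)^{|T|} if J = M(T) for some subset T of S, and C_{J, I(S)} = 0 if J is not of the form M(T) with T ⊆ S. -/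
attribute [local instance] Classical.propDecidable

open Matrix

variable {P : Type*}

/-- The lower closure of a subset `S` of a poset: all elements below some element of `S`. -/
def lowClosure [PartialOrder P] (S : Set P) : Set P := {x | ∃ s ∈ S, x ≤ s}

lemma isLowerSet_lowClosure [PartialOrder P] (S : Set P) :
    IsLowerSet (lowClosure S) := by
  rintro a b hba ⟨s, hs, hle⟩
  exact ⟨s, hs, hba.trans hle⟩

/-- `I(S)`: the lower closure of `S`, as an element of the lattice of lower sets. -/
def IsetL [PartialOrder P] (S : Set P) : LSet P :=
  ⟨lowClosure S, isLowerSet_lowClosure S⟩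

/-- `M(S)`: the complement of the upper closure of `S`, as an element of the lattice of
lower sets. -/
def MsetL [PartialOrder P] (S : Set P) : LSet P :=
  ⟨(upClosure S)ᶜ, isLowerSet_upClosure_compl S⟩

lemma zeta_isUnit_aux [PartialOrder P] [Fintype P]
    (Z : Matrix (LSet P) (LSet P) ℚ)
    (hZ : ∀ I J : LSet P, Z I J = if I.1 ⊆ J.1 then 1 else 0) : IsUnit Z := by
  rw [← Matrix.mulVec_injective_iff_isUnit]
  rw [← Matrix.coe_mulVecLin, injective_iff_map_eq_zero]
  intro v hv
  funext I
  induction I using (wellFounded_gt (α := LSet P)).induction with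
  | _ I ih =>
    have h := congrFun hv I
    simp only [Matrix.mulVecLin_apply, Matrix.mulVec, dotProduct, Pi.zero_apply] at h
    rw [Finset.sum_eq_single I] at h
    · simpa [hZ] using h
    · intro J _ hJ
      rw [hZ]
      split_ifs with hIJ
      · have : v J = 0 := ih J (lt_of_le_of_ne hIJ (Ne.symm hJ))
        simp [this]
      · simp
    · simp

lemma MsetL_subset_aux [PartialOrder P] {S T U : Finset P}
    (hS : IsAntichain (· ≤ ·) (S : Set P)) (hT : T ⊆ S) (hU : U ⊆ S)
    (h : MsetL (↑T : Set P) = MsetL (↑U : Set P)) : T ⊆ U := by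
  intro t ht
  have h1 : upClosure (↑T : Set P) = upClosure (↑U : Set P) :=
    compl_injective (congrArg Subtype.val h)
  have h2 : t ∈ upClosure (↑U : Set P) := h1 ▸ ⟨t, ht, le_rfl⟩
  obtain ⟨u, hu, hut⟩ := h2
  have : u = t := hS.eq (hU hu) (hT ht) hut
  exact this ▸ hu

lemma le_MsetL_aux [PartialOrder P] (J : LSet P) (T : Finset P) :
    J.1 ⊆ (MsetL (↑T : Set P)).1 ↔ ∀ t ∈ T, t ∉ J.1 := by
  constructor
  · intro h t ht htJ
    exact h htJ ⟨t, ht, le_rfl⟩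
  · rintro h x hx ⟨t, ht, htx⟩
    exact h t ht (J.2 htx hx)

lemma column_aux [PartialOrder P] [Fintype P]
    (Z : Matrix (LSet P) (LSet P) ℚ)
    (hZ : ∀ I J : LSet P, Z I J = if I.1 ⊆ J.1 then 1 else 0)
    (S : Finset P) (J : LSet P) :
    ∑ T ∈ S.powerset, (-1 : ℚ) ^ T.card * Z J (MsetL (↑T : Set P))
      = Z (IsetL (↑S : Set P)) J := by
  have h1 : ∑ T ∈ S.powerset, (-1 : ℚ) ^ T.card * Z J (MsetL (↑T : Set P))
      = ∑ T ∈ (S.filter (fun t => t ∉ J.1)).powerset, (-1 : ℚ) ^ T.card := by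
    simp only [hZ, le_MsetL_aux, mul_ite, mul_one, mul_zero]
    rw [← Finset.sum_filter]
    apply Finset.sum_congr _ (fun _ _ => rfl)
    ext T
    simp only [Finset.mem_filter, Finset.mem_powerset, Finset.subset_iff]
    grind
  have h2 := congrArg (Int.cast : ℤ → ℚ)
    (Finset.sum_powerset_neg_one_pow_card (x := S.filter (fun t => t ∉ J.1)))
  push_cast at h2
  rw [h1, h2, hZ]
  congr 1
  rw [Finset.filter_eq_empty_iff, eq_iff_iff]
  constructor
  · rintro h x ⟨s, hs, hxs⟩
    exact J.2 hxs (not_not.1 (h hs))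
  · intro h s hs hn
    exact hn (h ⟨s, hs, le_rfl⟩)

theorem coxeter_column_at_antichain [PartialOrder P] [Fintype P]
    (Z C : Matrix (LSet P) (LSet P) ℚ)
    (hZ : ∀ I J : LSet P, Z I J = if I.1 ⊆ J.1 then 1 else 0)
    (hC : C = -(Z⁻¹ * Zᵀ))
    (S : Finset P) (hS : IsAntichain (· ≤ ·) (S : Set P)) :
    (∀ T ⊆ S, C (MsetL (↑T : Set P)) (IsetL (↑S : Set P)) = -(-1 : ℚ) ^ T.card) ∧
    (∀ J : LSet P, (∀ T ⊆ S, J ≠ MsetL (↑T : Set P)) → C J (IsetL (↑S : Set P)) = 0) := by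
  have hu := zeta_isUnit_aux Z hZ
  have hdet : IsUnit Z.det := (Matrix.isUnit_iff_isUnit_det Z).1 hu
  let v : LSet P → ℚ := fun J =>
    ∑ T ∈ S.powerset, (-1 : ℚ) ^ T.card * (if J = MsetL (↑T : Set P) then 1 else 0)
  have hv : Z *ᵥ v = Zᵀ.col (IsetL (↑S : Set P)) := by
    funext J
    simp only [Matrix.mulVec, dotProduct, Matrix.col_apply, Matrix.transpose_apply, v]
    rw [← column_aux Z hZ S J]
    simp only [Finset.mul_sum]
    rw [Finset.sum_comm]
    apply Finset.sum_congr rfl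
    intro T _
    rw [Finset.sum_eq_single (MsetL (↑T : Set P))]
    · simp [mul_comm]
    · intro K _ hK
      simp [hK]
    · simp
  have hcol : ∀ J, C J (IsetL (↑S : Set P)) = - v J := by
    intro J
    have h3 : Z⁻¹ *ᵥ (Z *ᵥ v) = v := by
      rw [Matrix.mulVec_mulVec, Matrix.nonsing_inv_mul _ hdet, Matrix.one_mulVec]
    rw [hv] at h3
    rw [hC, Matrix.neg_apply, ← congrFun h3 J]
    rfl
  constructor
  · intro T hT
    rw [hcol]
    congr 1
    simp only [v]
    rw [Finset.sum_eq_single T]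
    · simp
    · intro U hU hne
      rw [if_neg, mul_zero]
      intro h
      rw [Finset.mem_powerset] at hU
      exact hne (Finset.Subset.antisymm (MsetL_subset_aux hS hU hT h.symm)
        (MsetL_subset_aux hS hT hU h))
    · intro h
      exact absurd (Finset.mem_powerset.2 hT) h
  · intro J hJ
    rw [hcol, neg_eq_zero]
    apply Finset.sum_eq_zero
    intro T hT
    rw [if_neg (hJ T (Finset.mem_powerset.1 hT)), mul_zero]
end

section
/- Let P be a finite poset. For every antichain S of P and every lower set J of P, one has ∑_{T ⊆ S} (-1)^{|T|} · [J ⊆ M(T)] = [I(S) ⊆ J], where the sum is over all subsets T of S, and [·] denotes the indicator taking value 1 if the stated containment holds and 0 otherwise. -/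
attribute [local instance] Classical.propDecidable

variable {P : Type*}

/-- `M(S)`: the complement of the upper closure of `S`. -/
def Mset [PartialOrder P] (S : Set P) : Set P := (upClosure S)ᶜ

theorem inclusion_exclusion_antichain [PartialOrder P] [Fintype P]
    (S : Finset P) (hS : IsAntichain (· ≤ ·) (S : Set P))
    (J : Set P) (hJ : IsLowerSet J) :
    ∑ T ∈ S.powerset,
        (-1 : ℤ) ^ T.card * (if J ⊆ Mset (↑T : Set P) then 1 else 0) =
      (if lowClosure (↑S : Set P) ⊆ J then 1 else 0) := by
  have h1 : ∀ T : Finset P, J ⊆ Mset (↑T : Set P) ↔ ∀ t ∈ T, t ∉ J := by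
    intro T
    constructor
    · intro h t ht htJ
      exact h htJ ⟨t, ht, le_refl t⟩
    · rintro h x hx ⟨t, ht, htx⟩
      exact h t ht (hJ htx hx)
  have h2 : lowClosure (↑S : Set P) ⊆ J ↔ S.filter (fun t => t ∉ J) = ∅ := by
    rw [Finset.filter_eq_empty_iff]
    constructor
    · intro h t ht htJ
      exact htJ (h ⟨t, ht, le_refl t⟩)
    · rintro h x ⟨t, ht, hxt⟩
      exact hJ hxt (not_not.mp (h ht))
  have h3 : S.powerset.filter (fun T : Finset P => J ⊆ Mset (↑T : Set P))
      = (S.filter (fun t => t ∉ J)).powerset := by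
    ext T
    rw [Finset.mem_filter, Finset.mem_powerset, Finset.mem_powerset, h1]
    constructor
    · rintro ⟨hT, h⟩ t ht
      exact Finset.mem_filter.mpr ⟨hT ht, h t ht⟩
    · intro h
      exact ⟨fun t ht => (Finset.mem_filter.mp (h ht)).1,
        fun t ht => (Finset.mem_filter.mp (h ht)).2⟩
  simp only [mul_ite, mul_one, mul_zero]
  rw [← Finset.sum_filter, h3, Finset.sum_powerset_neg_one_pow_card]
  simp only [h2]
end

section
/- Let P be a finite poset. The rowmotion map, which sends a lower set I of P to the complement of the upper closure of the set of maximal elements of I, is a bijection from the set of lower sets of P to itself. -/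
variable {P : Type*}

lemma le_of_upClosure_eq [PartialOrder P] [Finite P] {I J : Set P} (hJ : IsLowerSet J)
    (h : upClosure (maxElts I) = upClosure (maxElts J)) : I ⊆ J := by
  intro x hx
  obtain ⟨m, hxm, hm⟩ := (Set.toFinite I).exists_le_maximal hx
  have hmI : m ∈ maxElts I := ⟨hm.prop, fun b hb hlt => hm.not_gt hb hlt⟩
  have h1 : m ∈ upClosure (maxElts J) := h ▸ ⟨m, hmI, le_rfl⟩
  obtain ⟨s, hs, hsm⟩ := h1
  have h2 : s ∈ upClosure (maxElts I) := h ▸ ⟨s, hs, le_rfl⟩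
  obtain ⟨t, ht, hts⟩ := h2
  have htm : t = m := (hts.trans hsm).eq_of_not_lt (ht.2 m hmI.1)
  have hms : m ≤ s := htm ▸ hts
  exact hJ (hxm.trans hms) hs.1

theorem rowmotion_bijective [PartialOrder P] [Fintype P] :
    Function.Bijective (rowmoL : LSet P → LSet P) := by
  refine Finite.injective_iff_bijective.mp ?_
  intro I J h
  have h' : upClosure (maxElts I.1) = upClosure (maxElts J.1) :=
    compl_injective (congrArg Subtype.val h)
  exact Subtype.ext (Set.Subset.antisymm (le_of_upClosure_eq J.2 h') (le_of_upClosure_eq I.2 h'.symm))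
end
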